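/- arXiv:2307.05753 — 2 statements merged into one kernel-verified Lean document; each statement's English description precedes it below -/
import Mathlib

section
/- Let f(x) = ½ xᵀ A x + bᵀ x on ℝ^d with A symmetric positive semidefinite, let δ ≥ 0, ρ > 0, and let f̃ : ℝ^d → ℝ satisfy |f̃(z) − f(z)| ≤ δ for all z. Let ξ be a standard Gaussian vector on ℝ^d and define, for a fixed x, the estimators ∇̂_ρ f̃(x) = ((f̃(x + ρξ) − f̃(x))/ρ) · ξ and ∇̃f(x) = ⟨∇f(x), ξ⟩ · ξ (built from the same sample ξ). Then for every symmetric positive semidefinite d×d matrix B: E‖∇̂_ρ f̃(x) − ∇̃f(x)‖_B² ≤ (8 δ²/ρ²) tr(B) + (15 ρ²/2) tr(A)² tr(B). -/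
open MeasureTheory ProbabilityTheory Matrix
open scoped BigOperators

/-- The standard Gaussian measure `N(0, I_d)` on `ℝ^d`. -/
noncomputable def stdGaussian (d : ℕ) : Measure (Fin d → ℝ) :=
  Measure.pi fun _ => gaussianReal 0 1

namespace Stmt8

lemma exp_int (d : ℕ) (a : Fin d → ℝ) (t : ℝ) :
    Integrable (fun ξ : Fin d → ℝ => Real.exp (t * (a ⬝ᵥ ξ))) (_root_.stdGaussian d) := by
  have h : (fun ξ : Fin d → ℝ => Real.exp (t * (a ⬝ᵥ ξ)))
      = fun ξ => ∏ i, (fun (i : Fin d) (y : ℝ) => Real.exp ((t * a i) * y)) i (ξ i) := by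
    funext ξ
    rw [← Real.exp_sum]
    simp only [dotProduct, Finset.mul_sum, mul_assoc]
  rw [h]
  exact Integrable.fintype_prod (f := fun (i : Fin d) (y : ℝ) => Real.exp ((t * a i) * y))
    (fun i => integrable_exp_mul_gaussianReal _)

lemma mgf_eq (d : ℕ) (a : Fin d → ℝ) :
    mgf (fun ξ : Fin d → ℝ => a ⬝ᵥ ξ) (_root_.stdGaussian d)
      = fun t => Real.exp ((a ⬝ᵥ a) * t ^ 2 / 2) := by
  funext t
  have h : (fun ξ : Fin d → ℝ => Real.exp (t * (a ⬝ᵥ ξ)))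
      = fun ξ => ∏ i, (fun (i : Fin d) (y : ℝ) => Real.exp ((t * a i) * y)) i (ξ i) := by
    funext ξ
    rw [← Real.exp_sum]
    simp only [dotProduct, Finset.mul_sum, mul_assoc]
  have h2 : ∀ s : ℝ, ∫ y, Real.exp (s * y) ∂(gaussianReal 0 1) = Real.exp (s ^ 2 / 2) := by
    intro s
    have := congrFun (mgf_id_gaussianReal (μ := 0) (v := 1)) s
    simpa [mgf] using this
  unfold mgf _root_.stdGaussian
  rw [h, integral_fintype_prod_eq_prod (f := fun (i : Fin d) (y : ℝ) => Real.exp ((t * a i) * y))]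
  simp only [h2]
  rw [← Real.exp_sum]
  congr 1
  simp only [dotProduct, Finset.sum_mul, Finset.sum_div]
  exact Finset.sum_congr rfl fun i _ => by ring

lemma mem_int (d : ℕ) (a : Fin d → ℝ) :
    0 ∈ interior (integrableExpSet (fun ξ : Fin d → ℝ => a ⬝ᵥ ξ) (_root_.stdGaussian d)) := by
  have : integrableExpSet (fun ξ : Fin d → ℝ => a ⬝ᵥ ξ) (_root_.stdGaussian d) = Set.univ :=
    Set.eq_univ_of_forall fun t => exp_int d a t
  rw [this]; simp

lemma pow_int (d : ℕ) (a : Fin d → ℝ) (n : ℕ) :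
    Integrable (fun ξ : Fin d → ℝ => (a ⬝ᵥ ξ) ^ n) (_root_.stdGaussian d) := by
  simpa using integrable_pow_mul_exp_of_mem_interior_integrableExpSet (mem_int d a) n

lemma step (v : ℝ) (p p' : ℝ → ℝ) (hp : ∀ t, HasDerivAt p (p' t) t) :
    deriv (fun t => p t * Real.exp (v * t ^ 2 / 2))
      = fun t => (p' t + v * t * p t) * Real.exp (v * t ^ 2 / 2) := by
  funext t
  have h1 : HasDerivAt (fun t : ℝ => v * t ^ 2 / 2) (v * t) t := by
    have := (((hasDerivAt_id t).pow 2).const_mul v).div_const 2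
    refine this.congr_deriv ?_
    simp; ring
  refine ((hp t).mul h1.exp).deriv.trans ?_
  ring

lemma derivs (v : ℝ) :
    iteratedDeriv 2 (fun t : ℝ => Real.exp (v * t ^ 2 / 2)) 0 = v ∧
    iteratedDeriv 6 (fun t : ℝ => Real.exp (v * t ^ 2 / 2)) 0 = 15 * v ^ 3 := by
  have key : ∀ c0 c1 c2 c3 c4 c5 : ℝ,
      deriv (fun t => (c0 + c1 * t + c2 * t ^ 2 + c3 * t ^ 3 + c4 * t ^ 4 + c5 * t ^ 5)
          * Real.exp (v * t ^ 2 / 2))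
      = fun t => ((c1 + 2 * c2 * t + 3 * c3 * t ^ 2 + 4 * c4 * t ^ 3 + 5 * c5 * t ^ 4)
        + v * t * (c0 + c1 * t + c2 * t ^ 2 + c3 * t ^ 3 + c4 * t ^ 4 + c5 * t ^ 5))
          * Real.exp (v * t ^ 2 / 2) := by
    intro c0 c1 c2 c3 c4 c5
    apply step
    intro t
    have h := hasDerivAt_id t
    have := ((((((hasDerivAt_const t c0).add (h.const_mul c1)).add ((h.pow 2).const_mul c2)).add
      ((h.pow 3).const_mul c3)).add ((h.pow 4).const_mul c4)).add ((h.pow 5).const_mul c5))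
    refine this.congr_deriv ?_
    simp; ring
  have d1 : iteratedDeriv 1 (fun t : ℝ => Real.exp (v * t ^ 2 / 2))
      = fun t => (0 + v * t + 0 * t ^ 2 + 0 * t ^ 3 + 0 * t ^ 4 + 0 * t ^ 5)
        * Real.exp (v * t ^ 2 / 2) := by
    rw [iteratedDeriv_one]
    have := key 1 0 0 0 0 0
    simp only [zero_mul, add_zero, one_mul] at this
    rw [this]; funext t; ring
  have d2 : iteratedDeriv 2 (fun t : ℝ => Real.exp (v * t ^ 2 / 2))
      = fun t => (v + 0 * t + v ^ 2 * t ^ 2 + 0 * t ^ 3 + 0 * t ^ 4 + 0 * t ^ 5)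
        * Real.exp (v * t ^ 2 / 2) := by
    rw [iteratedDeriv_succ, d1, key]; funext t; ring
  have d3 : iteratedDeriv 3 (fun t : ℝ => Real.exp (v * t ^ 2 / 2))
      = fun t => (0 + (3 * v ^ 2) * t + 0 * t ^ 2 + v ^ 3 * t ^ 3 + 0 * t ^ 4 + 0 * t ^ 5)
        * Real.exp (v * t ^ 2 / 2) := by
    rw [iteratedDeriv_succ, d2, key]; funext t; ring
  have d4 : iteratedDeriv 4 (fun t : ℝ => Real.exp (v * t ^ 2 / 2))
      = fun t => (3 * v ^ 2 + 0 * t + (6 * v ^ 3) * t ^ 2 + 0 * t ^ 3 + v ^ 4 * t ^ 4 + 0 * t ^ 5)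
        * Real.exp (v * t ^ 2 / 2) := by
    rw [iteratedDeriv_succ, d3, key]; funext t; ring
  have d5 : iteratedDeriv 5 (fun t : ℝ => Real.exp (v * t ^ 2 / 2))
      = fun t => (0 + (15 * v ^ 3) * t + 0 * t ^ 2 + (10 * v ^ 4) * t ^ 3 + 0 * t ^ 4
          + v ^ 5 * t ^ 5) * Real.exp (v * t ^ 2 / 2) := by
    rw [iteratedDeriv_succ, d4, key]; funext t; ring
  constructor
  · rw [d2]; simp
  · rw [iteratedDeriv_succ, d5, key]; simp

lemma moment2 (d : ℕ) (a : Fin d → ℝ) :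
    ∫ ξ : Fin d → ℝ, (a ⬝ᵥ ξ) ^ 2 ∂(_root_.stdGaussian d) = a ⬝ᵥ a := by
  have h := iteratedDeriv_mgf_zero (mem_int d a) 2
  rw [mgf_eq, (derivs _).1] at h
  simpa using h.symm

lemma moment6 (d : ℕ) (a : Fin d → ℝ) :
    ∫ ξ : Fin d → ℝ, (a ⬝ᵥ ξ) ^ 6 ∂(_root_.stdGaussian d) = 15 * (a ⬝ᵥ a) ^ 3 := by
  have h := iteratedDeriv_mgf_zero (mem_int d a) 6
  rw [mgf_eq, (derivs _).2] at h
  simpa using h.symm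

lemma amgm (x y z : ℝ) (hx : 0 ≤ x) (hy : 0 ≤ y) (hz : 0 ≤ z) :
    x * y * z ≤ (x ^ 3 + y ^ 3 + z ^ 3) / 3 := by
  nlinarith [mul_nonneg (add_nonneg (add_nonneg hx hy) hz)
    (add_nonneg (add_nonneg (sq_nonneg (x - y)) (sq_nonneg (y - z))) (sq_nonneg (x - z)))]

lemma triple_int (d : ℕ) (a b c : Fin d → ℝ) :
    Integrable (fun ξ : Fin d → ℝ => (a ⬝ᵥ ξ) ^ 2 * (b ⬝ᵥ ξ) ^ 2 * (c ⬝ᵥ ξ) ^ 2)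
      (_root_.stdGaussian d) := by
  refine Integrable.mono' ((((pow_int d a 6).add (pow_int d b 6)).add
    (pow_int d c 6)).div_const 3) ?_ ?_
  · apply Continuous.aestronglyMeasurable
    unfold dotProduct
    fun_prop
  · refine Filter.Eventually.of_forall fun ξ => ?_
    rw [Real.norm_of_nonneg (by positivity)]
    have := amgm ((a ⬝ᵥ ξ) ^ 2) ((b ⬝ᵥ ξ) ^ 2) ((c ⬝ᵥ ξ) ^ 2)
      (sq_nonneg _) (sq_nonneg _) (sq_nonneg _)
    simp only [← pow_mul] at this
    simpa using this

lemma triple (d : ℕ) (a b c : Fin d → ℝ) :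
    ∫ ξ : Fin d → ℝ, (a ⬝ᵥ ξ) ^ 2 * (b ⬝ᵥ ξ) ^ 2 * (c ⬝ᵥ ξ) ^ 2 ∂(_root_.stdGaussian d)
      ≤ 15 * ((a ⬝ᵥ a) * (b ⬝ᵥ b) * (c ⬝ᵥ c)) := by
  have pos : ∀ a : Fin d → ℝ, a ≠ 0 → 0 < a ⬝ᵥ a := fun a h => by
    have h1 : 0 ≤ a ⬝ᵥ a := Finset.sum_nonneg fun i _ => mul_self_nonneg _
    exact lt_of_le_of_ne h1 fun h2 => h (dotProduct_self_eq_zero.mp h2.symm)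
  by_cases ha : a = 0
  · subst ha; simp
  by_cases hb : b = 0
  · subst hb; simp
  by_cases hc : c = 0
  · subst hc; simp
  have hp := pos a ha
  have hq := pos b hb
  have hr := pos c hc
  set p := a ⬝ᵥ a with hpd
  set q := b ⬝ᵥ b with hqd
  set r := c ⬝ᵥ c with hrd
  have ia := (pow_int d a 6).const_mul (p * q * r / (3 * p ^ 3))
  have ib := (pow_int d b 6).const_mul (p * q * r / (3 * q ^ 3))
  have ic := (pow_int d c 6).const_mul (p * q * r / (3 * r ^ 3))
  calc _ ≤ ∫ ξ : Fin d → ℝ, (p * q * r / (3 * p ^ 3) * (a ⬝ᵥ ξ) ^ 6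
        + p * q * r / (3 * q ^ 3) * (b ⬝ᵥ ξ) ^ 6
        + p * q * r / (3 * r ^ 3) * (c ⬝ᵥ ξ) ^ 6) ∂(_root_.stdGaussian d) := by
        refine integral_mono (triple_int d a b c) ((ia.add ib).add ic) fun ξ => ?_
        have := amgm ((a ⬝ᵥ ξ) ^ 2 / p) ((b ⬝ᵥ ξ) ^ 2 / q) ((c ⬝ᵥ ξ) ^ 2 / r)
          (by positivity) (by positivity) (by positivity)
        have h2 := mul_le_mul_of_nonneg_left this (by positivity : 0 ≤ p * q * r)
        calc _ = p * q * r * ((a ⬝ᵥ ξ) ^ 2 / p * ((b ⬝ᵥ ξ) ^ 2 / q) * ((c ⬝ᵥ ξ) ^ 2 / r)) := by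
              field_simp
          _ ≤ _ := h2
          _ = _ := by simp only [div_pow, ← pow_mul]; ring
    _ = 15 * (p * q * r) := by
        rw [integral_add (by exact ia.add ib) ic, integral_add ia ib, integral_const_mul,
          integral_const_mul, integral_const_mul, moment6, moment6, moment6,
          ← hpd, ← hqd, ← hrd]
        field_simp
        ring

open scoped MatrixOrder in
lemma factor (d : ℕ) (A : Matrix (Fin d) (Fin d) ℝ) (hA : A.PosSemidef) :
    ∃ L : Fin d → Fin d → ℝ, (∀ ξ : Fin d → ℝ, ξ ⬝ᵥ A.mulVec ξ = ∑ i, (L i ⬝ᵥ ξ) ^ 2) ∧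
      A.trace = ∑ i, L i ⬝ᵥ L i := by
  have : ∃ M : Matrix (Fin d) (Fin d) ℝ, A = star M * M := by
    open scoped Matrix.Norms.L2Operator in
    exact CStarAlgebra.nonneg_iff_eq_star_mul_self.mp hA.nonneg
  obtain ⟨M, rfl⟩ := this
  refine ⟨fun i => M i, fun ξ => ?_, ?_⟩
  · rw [← mulVec_mulVec, dotProduct_mulVec, star_eq_conjTranspose, vecMul_conjTranspose]
    simp [dotProduct, mulVec, sq]
  · rw [trace, star_eq_conjTranspose]
    simp only [diag_apply, mul_apply, conjTranspose_apply, dotProduct, star_trivial]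
    rw [Finset.sum_comm]

lemma quadB (d : ℕ) (B : Matrix (Fin d) (Fin d) ℝ) (hB : B.PosSemidef) :
    Integrable (fun ξ : Fin d → ℝ => ξ ⬝ᵥ B.mulVec ξ) (_root_.stdGaussian d) ∧
    ∫ ξ : Fin d → ℝ, ξ ⬝ᵥ B.mulVec ξ ∂(_root_.stdGaussian d) = B.trace := by
  obtain ⟨L, h1, h2⟩ := factor d B hB
  simp only [h1, h2]
  refine ⟨integrable_finsetSum _ fun i _ => pow_int d _ 2, ?_⟩
  rw [integral_finsetSum _ fun i _ => pow_int d _ 2]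
  simp only [moment2]

lemma quadAB (d : ℕ) (A B : Matrix (Fin d) (Fin d) ℝ) (hA : A.PosSemidef) (hB : B.PosSemidef) :
    Integrable (fun ξ : Fin d → ℝ => (ξ ⬝ᵥ A.mulVec ξ) ^ 2 * (ξ ⬝ᵥ B.mulVec ξ))
      (_root_.stdGaussian d) ∧
    ∫ ξ : Fin d → ℝ, (ξ ⬝ᵥ A.mulVec ξ) ^ 2 * (ξ ⬝ᵥ B.mulVec ξ) ∂(_root_.stdGaussian d)
      ≤ 15 * (A.trace ^ 2 * B.trace) := by
  obtain ⟨L, h1, h2⟩ := factor d A hA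
  obtain ⟨K, h3, h4⟩ := factor d B hB
  have e : ∀ u w : Fin d → ℝ, (∑ i, u i) ^ 2 * (∑ k, w k)
      = ∑ i, ∑ j, ∑ k, u i * u j * w k := by
    intro u w
    rw [sq, Finset.sum_mul_sum, Finset.sum_mul]
    refine Finset.sum_congr rfl fun i _ => ?_
    rw [Finset.sum_mul]
    exact Finset.sum_congr rfl fun j _ => by rw [Finset.mul_sum]
  simp only [h1, h2, h3, h4, e]
  have i1 : ∀ i j, Integrable (fun ξ : Fin d → ℝ =>
      ∑ k, (L i ⬝ᵥ ξ) ^ 2 * (L j ⬝ᵥ ξ) ^ 2 * (K k ⬝ᵥ ξ) ^ 2) (_root_.stdGaussian d) :=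
    fun i j => integrable_finsetSum _ fun k _ => triple_int d _ _ _
  have i2 : ∀ i, Integrable (fun ξ : Fin d → ℝ =>
      ∑ j, ∑ k, (L i ⬝ᵥ ξ) ^ 2 * (L j ⬝ᵥ ξ) ^ 2 * (K k ⬝ᵥ ξ) ^ 2) (_root_.stdGaussian d) :=
    fun i => integrable_finsetSum _ fun j _ => i1 i j
  refine ⟨integrable_finsetSum _ fun i _ => i2 i, ?_⟩
  rw [integral_finsetSum _ fun i _ => i2 i, Finset.mul_sum]
  refine Finset.sum_le_sum fun i _ => ?_
  rw [integral_finsetSum _ fun j _ => i1 i j, Finset.mul_sum]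
  refine Finset.sum_le_sum fun j _ => ?_
  rw [integral_finsetSum _ fun k _ => triple_int d _ _ _, Finset.mul_sum]
  exact Finset.sum_le_sum fun k _ => triple d _ _ _

end Stmt8

/-- For the quadratic `f(z) = ½ zᵀ A z + bᵀ z`, a
`δ`-approximate zeroth-order oracle `f̃`, and the two estimators
`∇̂_ρ f̃(x) = ((f̃(x+ρξ) − f̃(x))/ρ) ξ` and `∇̃f(x) = ⟨∇f(x), ξ⟩ ξ` built from
the same Gaussian sample `ξ`, the Mahalanobis error satisfies
`E‖∇̂_ρ f̃(x) − ∇̃f(x)‖_B² ≤ (8δ²/ρ²) tr B + (15ρ²/2) (tr A)² tr B`. -/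
theorem stmt_8 (d : ℕ) (A : Matrix (Fin d) (Fin d) ℝ) (hA : A.PosSemidef)
    (b : Fin d → ℝ) (δ ρ : ℝ) (hδ : 0 ≤ δ) (hρ : 0 < ρ)
    (f ftil : (Fin d → ℝ) → ℝ)
    (hfdef : ∀ z, f z = (1 / 2) * (z ⬝ᵥ A.mulVec z) + b ⬝ᵥ z)
    (hmeas : Measurable ftil)
    (horacle : ∀ z, |ftil z - f z| ≤ δ)
    (x : Fin d → ℝ)
    (B : Matrix (Fin d) (Fin d) ℝ) (hB : B.PosSemidef) :
    ∫ ξ, ((((ftil (x + ρ • ξ) - ftil x) / ρ) • ξ - ((A.mulVec x + b) ⬝ᵥ ξ) • ξ) ⬝ᵥ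
        B.mulVec ((((ftil (x + ρ • ξ) - ftil x) / ρ) • ξ - ((A.mulVec x + b) ⬝ᵥ ξ) • ξ)))
      ∂(stdGaussian d)
      ≤ 8 * δ ^ 2 / ρ ^ 2 * B.trace + 15 * ρ ^ 2 / 2 * A.trace ^ 2 * B.trace := by
  obtain ⟨iB, eB⟩ := Stmt8.quadB d B hB
  obtain ⟨iAB, eAB⟩ := Stmt8.quadAB d A B hA hB
  have nnB : ∀ ξ : Fin d → ℝ, 0 ≤ ξ ⬝ᵥ B.mulVec ξ := fun ξ => by
    simpa using hB.dotProduct_mulVec_nonneg ξ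
  have hsymm : ∀ ξ : Fin d → ℝ, ξ ⬝ᵥ A.mulVec x = x ⬝ᵥ A.mulVec ξ := fun ξ => by
    have hT : Aᵀ = A := by simpa [IsSymm] using hA.1
    rw [dotProduct_mulVec, ← mulVec_transpose, hT, dotProduct_comm]
  have hf : ∀ ξ : Fin d → ℝ, f (x + ρ • ξ) - f x
      = ρ * ((A.mulVec x + b) ⬝ᵥ ξ) + ρ ^ 2 / 2 * (ξ ⬝ᵥ A.mulVec ξ) := fun ξ => by
    rw [hfdef, hfdef]
    simp only [mulVec_add, mulVec_smul, dotProduct_add, add_dotProduct, smul_dotProduct,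
      dotProduct_smul, smul_eq_mul]
    rw [dotProduct_comm (A.mulVec x) ξ]
    linear_combination (-ρ / 2) * hsymm ξ
  have hint : ∀ ξ : Fin d → ℝ,
      ((((ftil (x + ρ • ξ) - ftil x) / ρ) • ξ - ((A.mulVec x + b) ⬝ᵥ ξ) • ξ) ⬝ᵥ
        B.mulVec ((((ftil (x + ρ • ξ) - ftil x) / ρ) • ξ - ((A.mulVec x + b) ⬝ᵥ ξ) • ξ)))
      = ((ftil (x + ρ • ξ) - ftil x) / ρ - (A.mulVec x + b) ⬝ᵥ ξ) ^ 2
        * (ξ ⬝ᵥ B.mulVec ξ) := fun ξ => by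
    rw [← sub_smul, mulVec_smul, smul_dotProduct, dotProduct_smul, smul_eq_mul, smul_eq_mul]
    ring
  simp only [hint]
  calc _ ≤ ∫ ξ : Fin d → ℝ, (8 * δ ^ 2 / ρ ^ 2 * (ξ ⬝ᵥ B.mulVec ξ)
        + ρ ^ 2 / 2 * ((ξ ⬝ᵥ A.mulVec ξ) ^ 2 * (ξ ⬝ᵥ B.mulVec ξ))) ∂(_root_.stdGaussian d) := by
        refine integral_mono_of_nonneg (Filter.Eventually.of_forall fun ξ =>
          mul_nonneg (sq_nonneg _) (nnB ξ)) ((iB.const_mul _).add (iAB.const_mul _))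
          (Filter.Eventually.of_forall fun ξ => ?_)
        have h1 := abs_le.mp (horacle (x + ρ • ξ))
        have h2 := abs_le.mp (horacle x)
        have h3 := hf ξ
        set Q := ξ ⬝ᵥ A.mulVec ξ
        obtain ⟨e, he⟩ : ∃ e, e = (ftil (x + ρ • ξ) - f (x + ρ • ξ)) - (ftil x - f x) := ⟨_, rfl⟩
        have hs : (ftil (x + ρ • ξ) - ftil x) / ρ - (A.mulVec x + b) ⬝ᵥ ξ
            = e / ρ + ρ / 2 * Q := by
          have : ftil (x + ρ • ξ) - ftil x
              = e + (ρ * ((A.mulVec x + b) ⬝ᵥ ξ) + ρ ^ 2 / 2 * Q) := by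
            rw [he, ← h3]; ring
          rw [this]; field_simp; ring
        have he2 : e ^ 2 ≤ 4 * δ ^ 2 := by
          have : |e| ≤ 2 * δ := abs_le.mpr ⟨by linarith [h1.1, h2.2], by linarith [h1.2, h2.1]⟩
          have := sq_le_sq' (abs_le.mp this).1 (abs_le.mp this).2
          linarith
        have hb : (e / ρ + ρ / 2 * Q) ^ 2 ≤ 8 * δ ^ 2 / ρ ^ 2 + ρ ^ 2 / 2 * Q ^ 2 := by
          have h5 : (e / ρ) ^ 2 ≤ 4 * δ ^ 2 / ρ ^ 2 := by
            rw [div_pow]; gcongr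
          have h6 : 8 * δ ^ 2 / ρ ^ 2 = 2 * (4 * δ ^ 2 / ρ ^ 2) := by ring
          rw [h6]
          nlinarith [sq_nonneg (e / ρ - ρ / 2 * Q)]
        have h7 := mul_le_mul_of_nonneg_right hb (nnB ξ)
        simp only [hs]
        linarith
    _ ≤ _ := by
        rw [integral_add (iB.const_mul _) (iAB.const_mul _), integral_const_mul,
          integral_const_mul, eB]
        have := mul_le_mul_of_nonneg_left eAB (by positivity : 0 ≤ ρ ^ 2 / 2)
        linarith
end

section
/- Let f(x) = ½ xᵀ A x + bᵀ x on ℝ^d with A symmetric positive semidefinite and tr(A) > 0, let δ ≥ 0, ρ > 0, and let f̃ be a δ-approximate zeroth-order oracle for f. Fix x ∈ ℝ^d, let ξ ~ N(0, I_d), set h = 1/(12 tr(A)) and x⁺ = x − h · ((f̃(x + ρξ) − f̃(x))/ρ) · ξ. Then E_ξ f(x⁺) ≤ f(x) − (1/(48 tr(A))) ‖∇f(x)‖² + C₁ ρ² + C₂ δ²/ρ², where C₁ = (5/16) tr(A) d + (5/384) tr(A) and C₂ = d/(3 tr(A)) + 1/(72 tr(A)). -/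
open MeasureTheory ProbabilityTheory Matrix
open scoped BigOperators

/-- Polynomials with `(d/dt)^n exp(t^2/2) = P_n(t) exp(t^2/2)`. -/
noncomputable def hermP : ℕ → Polynomial ℝ
  | 0 => 1
  | n + 1 => Polynomial.derivative (hermP n) + Polynomial.X * hermP n

lemma iteratedDeriv_gauss (n : ℕ) :
    iteratedDeriv n (fun t : ℝ => Real.exp (t ^ 2 / 2)) =
      fun t => (hermP n).eval t * Real.exp (t ^ 2 / 2) := by
  induction n with
  | zero => ext t; simp [hermP]
  | succ n ih =>
    rw [iteratedDeriv_succ, ih]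
    ext t
    have h1 : HasDerivAt (fun t : ℝ => t ^ 2 / 2) t t := by
      have := (hasDerivAt_pow 2 t).div_const 2
      have e : ((2 : ℕ) : ℝ) * t ^ (2 - 1) / 2 = t := by norm_num
      rwa [e] at this
    have h2 := ((hermP n).hasDerivAt t).mul h1.exp
    have h3 := h2.deriv
    simp only [Pi.mul_def] at h3
    rw [h3]
    simp [hermP]
    ring

lemma gaussian_moment (n : ℕ) :
    ∫ x, x ^ n ∂(gaussianReal 0 1) = (hermP n).eval 0 := by
  have h := iteratedDeriv_mgf_zero (X := fun x : ℝ => x) (μ := gaussianReal 0 1) (by simp) n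
  rw [mgf_fun_id_gaussianReal] at h
  have e : (fun t : ℝ => Real.exp (0 * t + ((1 : NNReal) : ℝ) * t ^ 2 / 2)) =
      fun t => Real.exp (t ^ 2 / 2) := by ext t; simp
  rw [e, iteratedDeriv_gauss] at h
  simpa using h.symm

lemma gaussian_integrable (n : ℕ) :
    Integrable (fun x : ℝ => x ^ n) (gaussianReal 0 1) :=
  integrable_pow_of_mem_interior_integrableExpSet (X := fun x : ℝ => x) (by simp) n

lemma hermP_two : (hermP 2).eval 0 = 1 := by simp [hermP]
lemma hermP_four : (hermP 4).eval 0 = 3 := by simp [hermP]; norm_num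
lemma hermP_six : (hermP 6).eval 0 = 15 := by simp [hermP]; norm_num

lemma map_dot {d : ℕ} (v : Fin d → ℝ) (hv : ∑ i, v i ^ 2 = 1) :
    (_root_.stdGaussian d).map (fun ξ => v ⬝ᵥ ξ) = gaussianReal 0 1 := by
  have h := map_pi_eq_stdGaussian (ι := Fin d)
  let L : StrongDual ℝ (EuclideanSpace ℝ (Fin d)) := innerSL ℝ (WithLp.toLp 2 v)
  have e : (fun ξ : Fin d → ℝ => v ⬝ᵥ ξ) = L ∘ (WithLp.toLp 2) := by
    ext ξ
    simp [L, dotProduct, PiLp.inner_apply, mul_comm]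
  have hn : ‖L‖ ^ 2 = 1 := by
    simp only [L, innerSL_apply_norm]
    rw [EuclideanSpace.norm_sq_eq]
    simpa using hv
  rw [e, ← Measure.map_map (by fun_prop) (by fun_prop), _root_.stdGaussian, h,
    IsGaussian.map_eq_gaussianReal, integral_strongDual_stdGaussian, variance_dual_stdGaussian, hn]
  simp

lemma dot_integrable {d : ℕ} (v : Fin d → ℝ) (hv : ∑ i, v i ^ 2 = 1) (n : ℕ) :
    Integrable (fun ξ => (v ⬝ᵥ ξ) ^ n) (_root_.stdGaussian d) := by
  have h := gaussian_integrable n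
  rw [← map_dot v hv] at h
  have hm : Measurable (fun ξ : Fin d → ℝ => v ⬝ᵥ ξ) := by
    unfold dotProduct; fun_prop
  exact (integrable_map_measure h.aestronglyMeasurable hm.aemeasurable).1 h

lemma dot_moment {d : ℕ} (v : Fin d → ℝ) (hv : ∑ i, v i ^ 2 = 1) (n : ℕ) :
    ∫ ξ, (v ⬝ᵥ ξ) ^ n ∂(_root_.stdGaussian d) = (hermP n).eval 0 := by
  rw [← gaussian_moment, ← map_dot v hv]
  have hm : Measurable (fun ξ : Fin d → ℝ => v ⬝ᵥ ξ) := by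
    unfold dotProduct; fun_prop
  rw [integral_map hm.aemeasurable (by fun_prop)]

lemma exists_unit {d : ℕ} (i₀ : Fin d) (g : Fin d → ℝ) :
    ∃ γ : ℝ, ∃ v : Fin d → ℝ, ∑ i, v i ^ 2 = 1 ∧ g = γ • v ∧ ∑ i, g i ^ 2 = γ ^ 2 := by
  by_cases hg : ∑ i, g i ^ 2 = 0
  · refine ⟨0, Pi.single i₀ 1, ?_, ?_, by simpa using hg⟩
    · simp [Pi.single_apply]
    · rw [Finset.sum_eq_zero_iff_of_nonneg (fun _ _ => sq_nonneg _)] at hg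
      ext i
      simpa using hg i (Finset.mem_univ i)
  · have hp : 0 < ∑ i, g i ^ 2 :=
      lt_of_le_of_ne (Finset.sum_nonneg fun _ _ => sq_nonneg _) (Ne.symm hg)
    have hs := Real.sqrt_pos.2 hp
    have hs2 := Real.sq_sqrt hp.le
    refine ⟨√(∑ i, g i ^ 2), (√(∑ i, g i ^ 2))⁻¹ • g, ?_, ?_, hs2.symm⟩
    · simp only [Pi.smul_apply, smul_eq_mul, mul_pow, ← Finset.mul_sum, inv_pow, hs2]
      exact inv_mul_cancel₀ hg
    · rw [smul_smul, mul_inv_cancel₀ hs.ne', one_smul]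

lemma exists_decomp {d : ℕ} (i₀ : Fin d) (A : Matrix (Fin d) (Fin d) ℝ) (hA : A.PosSemidef) :
    ∃ m : ℕ, ∃ l : Fin m → ℝ, ∃ v : Fin m → Fin d → ℝ, (∀ k, 0 ≤ l k) ∧
      (∀ k, ∑ i, v k i ^ 2 = 1) ∧ ∑ k, l k = A.trace ∧
      ∀ ξ : Fin d → ℝ, ξ ⬝ᵥ A.mulVec ξ = ∑ k, l k * (v k ⬝ᵥ ξ) ^ 2 := by
  obtain ⟨m, B, hB⟩ := Matrix.posSemidef_iff_eq_sum_vecMulVec.mp hA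
  choose γ v h1 h2 h3 using fun k => exists_unit i₀ (B k)
  refine ⟨m, fun k => γ k ^ 2, v, fun k => sq_nonneg _, h1, ?_, fun ξ => ?_⟩
  · rw [hB, Matrix.trace_sum]
    refine Finset.sum_congr rfl fun k _ => ?_
    change γ k ^ 2 = _
    rw [← h3, Matrix.trace_vecMulVec]
    simp [dotProduct, sq]
  · rw [hB, Matrix.sum_mulVec, dotProduct_sum]
    refine Finset.sum_congr rfl fun k _ => ?_
    rw [Matrix.vecMulVec_mulVec, ← mul_pow]
    have : γ k * (v k ⬝ᵥ ξ) = B k ⬝ᵥ ξ := by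
      conv_rhs => rw [h2 k]
      simp
    rw [this]
    simp [dotProduct_comm ξ]
    ring

lemma weighted_pow {m : ℕ} (l z : Fin m → ℝ) (hl : ∀ k, 0 ≤ l k) (hz : ∀ k, 0 ≤ z k) (T : ℝ)
    (hT : 0 < T) (hs : ∑ k, l k = T) (n : ℕ) :
    (∑ k, l k * z k) ^ (n + 1) ≤ T ^ n * ∑ k, l k * z k ^ (n + 1) := by
  have h := Real.pow_arith_mean_le_arith_mean_pow Finset.univ (fun k => l k / T) z
    (fun k _ => div_nonneg (hl k) hT.le) (by rw [← Finset.sum_div, hs, div_self hT.ne'])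
    (fun k _ => hz k) (n + 1)
  have e : ∀ y : Fin m → ℝ, ∑ k, l k / T * y k = (∑ k, l k * y k) / T := by
    intro y
    rw [Finset.sum_div]
    exact Finset.sum_congr rfl fun k _ => by ring
  rw [e, e (fun k => z k ^ (n + 1)), div_pow, div_le_iff₀ (by positivity)] at h
  calc _ ≤ _ := h
    _ = _ := by rw [pow_succ]; field_simp

lemma poly_integral {d m : ℕ} (t : Fin d → ℝ) (ht : ∑ i, t i ^ 2 = 1) (l : Fin m → ℝ)
    (v : Fin m → Fin d → ℝ) (hv : ∀ k, ∑ i, v k i ^ 2 = 1) (T : ℝ) (hs : ∑ k, l k = T)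
    (c0 c1 c2 c3 c4 c6 : ℝ) :
    Integrable (fun ξ => c0 + c1 * (t ⬝ᵥ ξ) ^ 2 + c2 * (t ⬝ᵥ ξ) ^ 4 +
      ∑ k, l k * (c3 * (v k ⬝ᵥ ξ) ^ 2 + c4 * (v k ⬝ᵥ ξ) ^ 4 + c6 * (v k ⬝ᵥ ξ) ^ 6))
      (_root_.stdGaussian d) ∧
    ∫ ξ, (c0 + c1 * (t ⬝ᵥ ξ) ^ 2 + c2 * (t ⬝ᵥ ξ) ^ 4 +
      ∑ k, l k * (c3 * (v k ⬝ᵥ ξ) ^ 2 + c4 * (v k ⬝ᵥ ξ) ^ 4 + c6 * (v k ⬝ᵥ ξ) ^ 6))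
      ∂(_root_.stdGaussian d) = c0 + c1 + 3 * c2 + T * (c3 + 3 * c4 + 15 * c6) := by
  have : IsProbabilityMeasure (_root_.stdGaussian d) := by
    unfold _root_.stdGaussian; infer_instance
  have i1 := (dot_integrable t ht 2).const_mul c1
  have i2 := (dot_integrable t ht 4).const_mul c2
  have i3 := fun k => (dot_integrable (v k) (hv k) 2).const_mul c3
  have i4 := fun k => (dot_integrable (v k) (hv k) 4).const_mul c4
  have i6 := fun k => (dot_integrable (v k) (hv k) 6).const_mul c6
  have j := fun k => (((i3 k).fun_add (i4 k)).fun_add (i6 k)).const_mul (l k)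
  have j0 := ((integrable_const (μ := _root_.stdGaussian d) c0).fun_add i1).fun_add i2
  have j1 := integrable_finsetSum Finset.univ (fun k _ => j k)
  refine ⟨j0.fun_add j1, ?_⟩
  rw [integral_add j0 j1, integral_add ((integrable_const c0).fun_add i1) i2,
    integral_add (integrable_const c0) i1, integral_finsetSum _ (fun k _ => j k)]
  have e : ∀ k, ∫ ξ, l k * (c3 * (v k ⬝ᵥ ξ) ^ 2 + c4 * (v k ⬝ᵥ ξ) ^ 4 + c6 * (v k ⬝ᵥ ξ) ^ 6)
      ∂(_root_.stdGaussian d) = l k * (c3 + 3 * c4 + 15 * c6) := by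
    intro k
    rw [integral_const_mul, integral_add ((i3 k).fun_add (i4 k)) (i6 k), integral_add (i3 k) (i4 k),
      integral_const_mul, integral_const_mul, integral_const_mul,
      dot_moment _ (hv k), dot_moment _ (hv k), dot_moment _ (hv k),
      hermP_two, hermP_four, hermP_six]
    ring
  have e' : ∑ k, ∫ ξ, l k * (c3 * (v k ⬝ᵥ ξ) ^ 2 + c4 * (v k ⬝ᵥ ξ) ^ 4 + c6 * (v k ⬝ᵥ ξ) ^ 6)
      ∂(_root_.stdGaussian d) = T * (c3 + 3 * c4 + 15 * c6) := by
    rw [← hs, Finset.sum_mul]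
    exact Finset.sum_congr rfl fun k _ => e k
  refine (congrArg₂ (· + ·) rfl e').trans ?_
  rw [integral_const_mul, integral_const_mul, dot_moment _ ht, dot_moment _ ht,
      hermP_two, hermP_four]
  simp
  ring

lemma quad_expand {d : ℕ} (A : Matrix (Fin d) (Fin d) ℝ) (hA : A.PosSemidef)
    (b x ξ : Fin d → ℝ) (c : ℝ) :
    (1 / 2) * ((x + c • ξ) ⬝ᵥ A.mulVec (x + c • ξ)) + b ⬝ᵥ (x + c • ξ) =
      (1 / 2) * (x ⬝ᵥ A.mulVec x) + b ⬝ᵥ x + c * ((A.mulVec x + b) ⬝ᵥ ξ)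
        + c ^ 2 / 2 * (ξ ⬝ᵥ A.mulVec ξ) := by
  have hs : Aᵀ = A := by simpa using hA.1.eq
  have e : x ⬝ᵥ A.mulVec ξ = A.mulVec x ⬝ᵥ ξ := by
    rw [Matrix.dotProduct_mulVec, ← Matrix.mulVec_transpose, hs]
  simp only [Matrix.mulVec_add, Matrix.mulVec_smul, add_dotProduct, dotProduct_add,
    smul_dotProduct, dotProduct_smul, smul_eq_mul, e, dotProduct_comm ξ (A.mulVec x)]
  ring

lemma scalar_bound (T h ρ η γ t Q e D S4 S6 : ℝ) (hT : 0 < T) (hh : 0 < h)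
    (hQ : 0 ≤ Q) (hQ2 : Q ^ 2 ≤ T * S4) (hQ3 : Q ^ 3 ≤ T ^ 2 * S6)
    (hm : t ^ 2 * Q ≤ (T * t ^ 4 + S4) / 2) (he : e ^ 2 ≤ η ^ 2)
    (hD : D = γ * t + ρ / 2 * Q + e) :
    -h * D * (γ * t) + h ^ 2 / 2 * D ^ 2 * Q ≤
      h * (10 / 11) * η ^ 2 - 5 / 8 * h * γ ^ 2 * t ^ 2 + 3 / 4 * h ^ 2 * γ ^ 2 * T * t ^ 4
      + (3 / 2 * h ^ 2 * η ^ 2 * Q + (5 / 8 * h * ρ ^ 2 * T + 3 / 4 * h ^ 2 * γ ^ 2) * S4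
        + 3 / 8 * h ^ 2 * ρ ^ 2 * T ^ 2 * S6) ∧
    - (h * (10 / 11) * η ^ 2) - 11 / 8 * h * γ ^ 2 * t ^ 2 - 5 / 8 * h * ρ ^ 2 * T * S4 ≤
      -h * D * (γ * t) + h ^ 2 / 2 * D ^ 2 * Q := by
  have a1 : D ^ 2 ≤ 3 * (γ ^ 2 * t ^ 2 + ρ ^ 2 / 4 * Q ^ 2 + e ^ 2) := by
    rw [hD]
    nlinarith [sq_nonneg (γ * t - ρ / 2 * Q), sq_nonneg (γ * t - e), sq_nonneg (ρ / 2 * Q - e)]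
  have a2 : D ^ 2 * Q ≤ 3 * (γ ^ 2 * ((T * t ^ 4 + S4) / 2) + ρ ^ 2 / 4 * (T ^ 2 * S6)
      + η ^ 2 * Q) := by
    calc D ^ 2 * Q ≤ 3 * (γ ^ 2 * t ^ 2 + ρ ^ 2 / 4 * Q ^ 2 + e ^ 2) * Q := by gcongr
      _ = 3 * (γ ^ 2 * (t ^ 2 * Q) + ρ ^ 2 / 4 * Q ^ 3 + e ^ 2 * Q) := by ring
      _ ≤ _ := by gcongr
  have a3 : ρ ^ 2 * Q ^ 2 ≤ ρ ^ 2 * (T * S4) := by gcongr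
  have b1 : -(D * (γ * t)) ≤ -(5 / 8 * γ ^ 2 * t ^ 2) + 5 / 8 * (ρ ^ 2 * (T * S4))
      + 10 / 11 * η ^ 2 := by
    rw [hD]
    nlinarith [sq_nonneg (γ * t + 10 * (ρ / 4 * Q)), sq_nonneg (γ * t + 20 / 11 * e)]
  have b2 : -(11 / 8 * γ ^ 2 * t ^ 2) - 5 / 8 * (ρ ^ 2 * (T * S4))
      - 10 / 11 * η ^ 2 ≤ -(D * (γ * t)) := by
    rw [hD]
    nlinarith [sq_nonneg (γ * t - 10 * (ρ / 4 * Q)), sq_nonneg (γ * t - 20 / 11 * e)]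
  have c1 := mul_le_mul_of_nonneg_left b1 hh.le
  have c2 := mul_le_mul_of_nonneg_left b2 hh.le
  have c3 := mul_le_mul_of_nonneg_left a2 (by positivity : 0 ≤ h ^ 2 / 2)
  have c4 : 0 ≤ h ^ 2 / 2 * D ^ 2 * Q := by positivity
  constructor <;> linarith

lemma final_bound (T ρ δ γ n fx : ℝ) (hT : 0 < T) (hρ : 0 < ρ) (hn : 1 ≤ n) (h : ℝ)
    (hh : h = 1 / (12 * T)) (η : ℝ) (hη : η = 2 * δ / ρ) :
    (fx + h * (10 / 11) * η ^ 2) + (-(5 / 8 * h * γ ^ 2)) + 3 * (3 / 4 * h ^ 2 * γ ^ 2 * T)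
      + T * (3 / 2 * h ^ 2 * η ^ 2 + 3 * (5 / 8 * h * ρ ^ 2 * T + 3 / 4 * h ^ 2 * γ ^ 2)
        + 15 * (3 / 8 * h ^ 2 * ρ ^ 2 * T ^ 2)) ≤
    fx - 1 / (48 * T) * γ ^ 2 + (5 / 16 * T * n + 5 / 384 * T) * ρ ^ 2
      + (n / (3 * T) + 1 / (72 * T)) * δ ^ 2 / ρ ^ 2 := by
  subst hh hη
  have e1 : (fx + 1 / (12 * T) * (10 / 11) * (2 * δ / ρ) ^ 2) + (-(5 / 8 * (1 / (12 * T)) * γ ^ 2))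
      + 3 * (3 / 4 * (1 / (12 * T)) ^ 2 * γ ^ 2 * T)
      + T * (3 / 2 * (1 / (12 * T)) ^ 2 * (2 * δ / ρ) ^ 2
        + 3 * (5 / 8 * (1 / (12 * T)) * ρ ^ 2 * T + 3 / 4 * (1 / (12 * T)) ^ 2 * γ ^ 2)
        + 15 * (3 / 8 * (1 / (12 * T)) ^ 2 * ρ ^ 2 * T ^ 2)) =
      fx - 1 / (48 * T) * γ ^ 2 + (5 / 32 + 5 / 128) * (T * ρ ^ 2)
        + (10 / 33 + 1 / 24) * (δ ^ 2 / (T * ρ ^ 2)) := by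
    field_simp
    ring
  have e2 : (n / (3 * T) + 1 / (72 * T)) * δ ^ 2 / ρ ^ 2 =
      (n / 3 + 1 / 72) * (δ ^ 2 / (T * ρ ^ 2)) := by
    field_simp
  rw [e1, e2]
  have p1 : 0 ≤ T * ρ ^ 2 := by positivity
  have p2 : 0 ≤ δ ^ 2 / (T * ρ ^ 2) := by positivity
  nlinarith [mul_le_mul_of_nonneg_right hn p1, mul_le_mul_of_nonneg_right hn p2]

/-- One-step expected descent of the random-gradient method
`x⁺ = x − h ((f̃(x+ρξ) − f̃(x))/ρ) ξ`, `h = 1/(12 tr A)`, on the PSD quadratic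
`f(z) = ½ zᵀ A z + bᵀ z` with a `δ`-approximate zeroth-order oracle `f̃`. -/
theorem stmt_9 (d : ℕ) (A : Matrix (Fin d) (Fin d) ℝ) (hA : A.PosSemidef)
    (htr : 0 < A.trace)
    (b : Fin d → ℝ) (δ ρ : ℝ) (hδ : 0 ≤ δ) (hρ : 0 < ρ)
    (f ftil : (Fin d → ℝ) → ℝ)
    (hfdef : ∀ z, f z = (1 / 2) * (z ⬝ᵥ A.mulVec z) + b ⬝ᵥ z)
    (hmeas : Measurable ftil)
    (horacle : ∀ z, |ftil z - f z| ≤ δ)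
    (x : Fin d → ℝ) (h : ℝ) (hh : h = 1 / (12 * A.trace))
    (C₁ C₂ : ℝ)
    (hC₁ : C₁ = 5 / 16 * A.trace * d + 5 / 384 * A.trace)
    (hC₂ : C₂ = d / (3 * A.trace) + 1 / (72 * A.trace)) :
    ∫ ξ, f (x - h • (((ftil (x + ρ • ξ) - ftil x) / ρ) • ξ)) ∂(stdGaussian d)
      ≤ f x - 1 / (48 * A.trace) * (∑ i, ((A.mulVec x + b) i) ^ 2)
        + C₁ * ρ ^ 2 + C₂ * δ ^ 2 / ρ ^ 2 := by
  have hd : 0 < d := by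
    rcases Nat.eq_zero_or_pos d with h0 | h0
    · subst h0
      simp [Matrix.trace] at htr
    · exact h0
  obtain ⟨m, l, v, hl, hv, hT, hQ⟩ := exists_decomp ⟨0, hd⟩ A hA
  obtain ⟨γ, t, ht, hg, hg2⟩ := exists_unit ⟨0, hd⟩ (A.mulVec x + b)
  have hh0 : 0 < h := by rw [hh]; positivity
  generalize hTT : A.trace = T at *
  set η : ℝ := 2 * δ / ρ with hη
  have key : ∀ ξ : Fin d → ℝ, _ := fun ξ =>
    scalar_bound T h ρ η γ (t ⬝ᵥ ξ) (∑ k, l k * (v k ⬝ᵥ ξ) ^ 2)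
      ((ftil (x + ρ • ξ) - f (x + ρ • ξ) - (ftil x - f x)) / ρ)
      ((ftil (x + ρ • ξ) - ftil x) / ρ)
      (∑ k, l k * (v k ⬝ᵥ ξ) ^ 4) (∑ k, l k * (v k ⬝ᵥ ξ) ^ 6) htr hh0
      (Finset.sum_nonneg fun k _ => mul_nonneg (hl k) (sq_nonneg _))
      (by
        have := weighted_pow l (fun k => (v k ⬝ᵥ ξ) ^ 2) hl (fun k => sq_nonneg _) T htr hT 1
        simpa [← pow_mul] using this)
      (by
        have := weighted_pow l (fun k => (v k ⬝ᵥ ξ) ^ 2) hl (fun k => sq_nonneg _) T htr hT 2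
        simpa [← pow_mul] using this)
      (by
        rw [← hT, Finset.sum_mul, Finset.mul_sum, ← Finset.sum_add_distrib, Finset.sum_div]
        refine Finset.sum_le_sum fun k _ => ?_
        nlinarith [mul_nonneg (hl k) (sq_nonneg ((t ⬝ᵥ ξ) ^ 2 - (v k ⬝ᵥ ξ) ^ 2))])
      (by
        apply sq_le_sq'
        · rw [hη, ← neg_div]
          gcongr
          have := abs_le.1 (horacle x)
          have := abs_le.1 (horacle (x + ρ • ξ))
          linarith
        · rw [hη]
          gcongr
          have := abs_le.1 (horacle x)
          have := abs_le.1 (horacle (x + ρ • ξ))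
          linarith)
      (by
        rw [hfdef (x + ρ • ξ), quad_expand A hA, ← hfdef, hg, hQ, smul_dotProduct, smul_eq_mul]
        field_simp
        ring)
  have hF : ∀ ξ : Fin d → ℝ, f (x - h • (((ftil (x + ρ • ξ) - ftil x) / ρ) • ξ)) =
      f x + (-h * ((ftil (x + ρ • ξ) - ftil x) / ρ) * (γ * (t ⬝ᵥ ξ))
        + h ^ 2 / 2 * ((ftil (x + ρ • ξ) - ftil x) / ρ) ^ 2 * ∑ k, l k * (v k ⬝ᵥ ξ) ^ 2) := by
    intro ξ
    have e : x - h • (((ftil (x + ρ • ξ) - ftil x) / ρ) • ξ) =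
        x + (-h * ((ftil (x + ρ • ξ) - ftil x) / ρ)) • ξ := by
      rw [smul_smul, neg_mul, neg_smul, sub_eq_add_neg]
    rw [e, hfdef, quad_expand A hA, ← hfdef, hg, hQ, smul_dotProduct, smul_eq_mul]
    ring
  obtain ⟨iU, eU⟩ := poly_integral t ht l v hv T hT
    (f x + h * (10 / 11) * η ^ 2) (-(5 / 8 * h * γ ^ 2)) (3 / 4 * h ^ 2 * γ ^ 2 * T)
    (3 / 2 * h ^ 2 * η ^ 2) (5 / 8 * h * ρ ^ 2 * T + 3 / 4 * h ^ 2 * γ ^ 2)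
    (3 / 8 * h ^ 2 * ρ ^ 2 * T ^ 2)
  obtain ⟨iL, -⟩ := poly_integral t ht l v hv T hT
    (f x - h * (10 / 11) * η ^ 2) (-(11 / 8 * h * γ ^ 2)) 0
    0 (-(5 / 8 * h * ρ ^ 2 * T)) 0
  have hsum : ∀ (ξ : Fin d → ℝ) (c3 c4 c6 : ℝ),
      ∑ k, l k * (c3 * (v k ⬝ᵥ ξ) ^ 2 + c4 * (v k ⬝ᵥ ξ) ^ 4 + c6 * (v k ⬝ᵥ ξ) ^ 6) =
      c3 * (∑ k, l k * (v k ⬝ᵥ ξ) ^ 2) + c4 * (∑ k, l k * (v k ⬝ᵥ ξ) ^ 4)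
        + c6 * (∑ k, l k * (v k ⬝ᵥ ξ) ^ 6) := by
    intro ξ c3 c4 c6
    simp only [Finset.mul_sum, ← Finset.sum_add_distrib]
    exact Finset.sum_congr rfl fun k _ => by ring
  simp only [hsum] at iU eU iL
  simp only [hF]
  have hdm : ∀ w : Fin d → ℝ, Measurable (fun ξ : Fin d → ℝ => w ⬝ᵥ ξ) := by
    intro w
    unfold dotProduct
    fun_prop
  have hm1 := hdm t
  have hm2 := fun k => hdm (v k)
  have hm3 : Measurable (fun ξ : Fin d → ℝ => ftil (x + ρ • ξ)) := hmeas.comp (by fun_prop)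
  have iF := integrable_of_le_of_le (μ := _root_.stdGaussian d)
    (f := fun ξ => f x + (-h * ((ftil (x + ρ • ξ) - ftil x) / ρ) * (γ * (t ⬝ᵥ ξ))
        + h ^ 2 / 2 * ((ftil (x + ρ • ξ) - ftil x) / ρ) ^ 2 * ∑ k, l k * (v k ⬝ᵥ ξ) ^ 2))
    (Measurable.aestronglyMeasurable (by fun_prop))
    (ae_of_all _ fun ξ => by have := (key ξ).2; linarith)
    (ae_of_all _ fun ξ => by have := (key ξ).1; linarith) iL iU
  refine (integral_mono iF iU fun ξ => ?_).trans ?_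
  · have := (key ξ).1
    dsimp only
    linarith
  · rw [eU, hg2, hC₁, hC₂]
    exact final_bound T ρ δ γ d (f x) htr hρ (by exact_mod_cast hd) h hh η hη
end
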